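/- For t, C > 0 and x ≥ 0, with f_{t,x}(z) := z²·cos(xz)/(C²+z²)·e^{−tz²/2} and g_{t,x}(z) := C·z·sin(xz)/(C²+z²)·e^{−tz²/2}, one has 2·∫₀^∞ [f_{t,x}(z) − g_{t,x}(z)] dz = √(2π/t)·e^{−x²/(2t)} + 2πC·e^{−Cx+tC²/2}·(Φ(√t·C − x/√t) − 1). -/

import Mathlib

open MeasureTheory Real

/-- Standard normal cumulative distribution function. -/
noncomputable def stdNormalCDF (x : ℝ) : ℝ :=
  ∫ u in Set.Iic x, Real.exp (-u ^ 2 / 2) / Real.sqrt (2 * Real.pi)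

lemma aux_gauss_int (t : ℝ) (ht : 0 < t) :
    Integrable (fun z : ℝ => Real.exp (-t * z ^ 2 / 2)) := by
  have := integrable_exp_neg_mul_sq (half_pos ht)
  refine this.congr (Filter.Eventually.of_forall fun z => ?_)
  simp only
  congr 1; ring

lemma aux_fourier (t y : ℝ) (ht : 0 < t) :
    2 * ∫ z in Set.Ioi (0 : ℝ), Real.cos (y * z) * Real.exp (-t * z ^ 2 / 2) =
      Real.sqrt (2 * Real.pi / t) * Real.exp (-y ^ 2 / (2 * t)) := by
  have h1 := fourierIntegral_gaussian (b := ((t / 2 : ℝ) : ℂ)) (by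
    rw [Complex.ofReal_re]; exact half_pos ht) (y : ℂ)
  have hint : Integrable (fun z : ℝ => Complex.exp (Complex.I * y * z) *
      Complex.exp (-((t / 2 : ℝ) : ℂ) * z ^ 2)) := by
    have := integrable_cexp_quadratic (b := ((t / 2 : ℝ) : ℂ)) (by
      rw [Complex.ofReal_re]; exact half_pos ht) (Complex.I * y) 0
    refine this.congr (Filter.Eventually.of_forall fun z => ?_)
    simp only
    rw [← Complex.exp_add]; congr 1; ring
  have h2 := congrArg Complex.re h1
  have h3 : (∫ z : ℝ, Complex.exp (Complex.I * y * z) *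
      Complex.exp (-((t / 2 : ℝ) : ℂ) * z ^ 2)).re =
      ∫ z : ℝ, Real.cos (y * z) * Real.exp (-t * z ^ 2 / 2) := by
    rw [← RCLike.re_eq_complex_re, ← integral_re hint]
    congr 1; ext z
    have e1 : Complex.I * y * z = ((y * z : ℝ) : ℂ) * Complex.I := by push_cast; ring
    have e2 : -((t / 2 : ℝ) : ℂ) * z ^ 2 = ((-t * z ^ 2 / 2 : ℝ) : ℂ) := by push_cast; ring
    rw [e1, e2, RCLike.re_eq_complex_re, ← Complex.ofReal_exp, Complex.re_mul_ofReal,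
      Complex.exp_ofReal_mul_I_re]
  have h4 : (((Real.pi : ℂ) / ((t / 2 : ℝ) : ℂ)) ^ (1 / 2 : ℂ) *
      Complex.exp (-(y : ℂ) ^ 2 / (4 * ((t / 2 : ℝ) : ℂ)))).re =
      Real.sqrt (2 * Real.pi / t) * Real.exp (-y ^ 2 / (2 * t)) := by
    have e1 : ((Real.pi : ℂ) / ((t / 2 : ℝ) : ℂ)) ^ (1 / 2 : ℂ) =
        ((Real.sqrt (2 * Real.pi / t) : ℝ) : ℂ) := by
      rw [Real.sqrt_eq_rpow, Complex.ofReal_cpow (by positivity)]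
      congr 1
      · push_cast; field_simp
      · push_cast; rfl
    have e2 : -(y : ℂ) ^ 2 / (4 * ((t / 2 : ℝ) : ℂ)) = ((-y ^ 2 / (2 * t) : ℝ) : ℂ) := by
      push_cast
      congr 1
      ring
    rw [e1, e2, ← Complex.ofReal_exp, ← Complex.ofReal_mul, Complex.ofReal_re]
  rw [h3, h4] at h2
  rw [← h2, ← integral_comp_abs (f := fun z => Real.cos (y * z) * Real.exp (-t * z ^ 2 / 2))]
  congr 1; ext z
  rw [sq_abs]
  congr 1
  rcases abs_choice z with h | h <;> rw [h]
  rw [mul_neg, Real.cos_neg]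

lemma aux_laplace (C x z : ℝ) (hC : 0 < C) :
    ∫ s in Set.Ioi (0 : ℝ), Real.exp (-C * s) * Real.cos ((x - s) * z) =
      (C * Real.cos (x * z) + z * Real.sin (x * z)) / (C ^ 2 + z ^ 2) := by
  have hpos : C ^ 2 + z ^ 2 ≠ 0 := by positivity
  have hexp : Filter.Tendsto (fun s : ℝ => Real.exp (-C * s)) Filter.atTop (nhds 0) :=
    Real.tendsto_exp_atBot.comp
      (Filter.tendsto_id.const_mul_atTop_of_neg (neg_neg_iff_pos.2 hC))
  have := integral_Ioi_of_hasDerivAt_of_tendsto' (a := (0 : ℝ)) (m := (0 : ℝ))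
    (f := fun s => Real.exp (-C * s) *
      ((-C * Real.cos ((x - s) * z) - z * Real.sin ((x - s) * z)) / (C ^ 2 + z ^ 2)))
    (f' := fun s => Real.exp (-C * s) * Real.cos ((x - s) * z)) ?_ ?_ ?_
  · rw [this]; simp; ring
  · intro s _
    have hθ : HasDerivAt (fun s : ℝ => (x - s) * z) (-z) s := by
      simpa using ((hasDerivAt_id s).const_sub x).mul_const z
    have he : HasDerivAt (fun s : ℝ => Real.exp (-C * s)) (Real.exp (-C * s) * (-C)) s := by
      simpa using ((hasDerivAt_id s).const_mul (-C)).exp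
    have := he.mul ((((hθ.cos).const_mul (-C)).sub ((hθ.sin).const_mul z)).div_const (C ^ 2 + z ^ 2))
    refine this.congr_deriv ?_
    simp only [Pi.sub_apply]
    field_simp
    ring
  · refine Integrable.mono' (exp_neg_integrableOn_Ioi 0 hC) (by fun_prop) ?_
    refine Filter.Eventually.of_forall fun s => ?_
    rw [norm_mul, Real.norm_of_nonneg (Real.exp_pos _).le]
    exact mul_le_of_le_one_right (Real.exp_pos _).le (Real.abs_cos_le_one _)
  · refine squeeze_zero_norm (a := fun s => Real.exp (-C * s) * ((C + |z|) / (C ^ 2 + z ^ 2))) ?_ ?_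
    · intro s
      rw [norm_mul, Real.norm_of_nonneg (Real.exp_pos _).le, norm_div,
        Real.norm_of_nonneg (by positivity : 0 ≤ C ^ 2 + z ^ 2)]
      gcongr
      refine (norm_sub_le _ _).trans ?_
      rw [norm_mul, norm_mul, norm_neg, Real.norm_of_nonneg hC.le]
      gcongr
      · exact mul_le_of_le_one_right hC.le (Real.abs_cos_le_one _)
      · exact mul_le_of_le_one_right (abs_nonneg _) (Real.abs_sin_le_one _)
    · simpa using hexp.mul_const ((C + |z|) / (C ^ 2 + z ^ 2))

lemma aux_cdf (w : ℝ) :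
    ∫ u in Set.Ioi w, Real.exp (-u ^ 2 / 2) = Real.sqrt (2 * Real.pi) * (1 - stdNormalCDF w) := by
  have hi : Integrable (fun u : ℝ => Real.exp (-u ^ 2 / 2)) := by
    simpa using aux_gauss_int 1 one_pos
  have h1 := intervalIntegral.integral_Iic_add_Ioi (b := w) hi.integrableOn hi.integrableOn
  have h2 : ∫ u : ℝ, Real.exp (-u ^ 2 / 2) = Real.sqrt (2 * Real.pi) := by
    have := integral_gaussian (1 / 2)
    rw [show Real.pi / (1 / 2) = 2 * Real.pi by ring] at this
    rw [← this]; congr 1; ext u; congr 1; ring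
  have hs : Real.sqrt (2 * Real.pi) ≠ 0 := by positivity
  have h3 : stdNormalCDF w * Real.sqrt (2 * Real.pi) = ∫ u in Set.Iic w, Real.exp (-u ^ 2 / 2) := by
    unfold stdNormalCDF
    rw [integral_div]
    field_simp
  rw [h2, ← h3] at h1
  linarith

lemma aux_shift (t C x : ℝ) (ht : 0 < t) :
    ∫ s in Set.Ioi (0 : ℝ), Real.exp (-C * s) * Real.exp (-(x - s) ^ 2 / (2 * t)) =
      Real.exp (-C * x + t * C ^ 2 / 2) * (Real.sqrt t * (Real.sqrt (2 * Real.pi) *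
        (1 - stdNormalCDF (Real.sqrt t * C - x / Real.sqrt t)))) := by
  have hr : 0 < Real.sqrt t := Real.sqrt_pos.2 ht
  have hrt : Real.sqrt t ^ 2 = t := Real.sq_sqrt ht.le
  set r := Real.sqrt t with hrdef
  have hi : Integrable (fun u : ℝ => Real.exp (-u ^ 2 / 2)) := by
    simpa using aux_gauss_int 1 one_pos
  have hsub := integral_comp_mul_deriv_Ioi (a := 0) (f := fun s : ℝ => s / r + (r * C - x / r))
    (f' := fun _ => 1 / r) (g := fun u : ℝ => Real.exp (-u ^ 2 / 2)) (by fun_prop)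
    (Filter.tendsto_atTop_add_const_right _ _ (Filter.tendsto_id.atTop_div_const hr))
    (fun s _ => (((hasDerivAt_id s).div_const r).add_const _).hasDerivWithinAt)
    (by fun_prop) hi.integrableOn
    (((hi.comp_add_right (r * C - x / r)).comp_div hr.ne').mul_const (1 / r)).integrableOn
  simp only [zero_div, zero_add, Function.comp_def] at hsub
  rw [aux_cdf, integral_mul_const] at hsub
  rw [← hsub]
  have : ∀ I : ℝ, r * (I * (1 / r)) = I := fun I => by field_simp
  rw [this, ← integral_const_mul]
  congr 1; ext s
  rw [← Real.exp_add, ← Real.exp_add]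
  congr 1
  rw [← hrt]
  field_simp
  ring

theorem integral_f_sub_g (t C x : ℝ) (ht : 0 < t) (hC : 0 < C) (hx : 0 ≤ x) :
    2 * ∫ z in Set.Ioi (0 : ℝ),
        (z ^ 2 * Real.cos (x * z) / (C ^ 2 + z ^ 2) * Real.exp (-t * z ^ 2 / 2) -
          C * z * Real.sin (x * z) / (C ^ 2 + z ^ 2) * Real.exp (-t * z ^ 2 / 2)) =
      Real.sqrt (2 * Real.pi / t) * Real.exp (-x ^ 2 / (2 * t)) +
        2 * Real.pi * C * Real.exp (-C * x + t * C ^ 2 / 2) *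
          (stdNormalCDF (Real.sqrt t * C - x / Real.sqrt t) - 1) := by
  have hE := aux_gauss_int t ht
  have hEO : IntegrableOn (fun z : ℝ => Real.exp (-t * z ^ 2 / 2)) (Set.Ioi 0) := hE.integrableOn
  have hCO := exp_neg_integrableOn_Ioi 0 hC
  -- the joint integrand
  have hprod : Integrable (Function.uncurry fun z s : ℝ =>
      Real.exp (-C * s) * Real.cos ((x - s) * z) * Real.exp (-t * z ^ 2 / 2))
      ((volume.restrict (Set.Ioi (0 : ℝ))).prod (volume.restrict (Set.Ioi (0 : ℝ)))) := by
    refine Integrable.mono' (Integrable.mul_prod hEO hCO) ?_ ?_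
    · refine Continuous.aestronglyMeasurable ?_
      simp only [Function.uncurry_def]
      fun_prop
    · refine Filter.Eventually.of_forall fun p => ?_
      simp only [Function.uncurry_def]
      rw [norm_mul, norm_mul, Real.norm_of_nonneg (Real.exp_pos _).le,
        Real.norm_of_nonneg (Real.exp_pos _).le, mul_comm]
      gcongr
      exact mul_le_of_le_one_right (Real.exp_pos _).le (Real.abs_cos_le_one _)
  have hswap := integral_integral_swap hprod
  have hinner := hprod.integral_prod_left
  simp only [Function.uncurry_def] at hinner
  have hL : ∀ z : ℝ, ∫ s in Set.Ioi (0 : ℝ),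
      Real.exp (-C * s) * Real.cos ((x - s) * z) * Real.exp (-t * z ^ 2 / 2) =
      (C * Real.cos (x * z) + z * Real.sin (x * z)) / (C ^ 2 + z ^ 2) *
        Real.exp (-t * z ^ 2 / 2) := by
    intro z
    rw [integral_mul_const, aux_laplace C x z hC]
  have hR : ∀ s : ℝ, ∫ z in Set.Ioi (0 : ℝ),
      Real.exp (-C * s) * Real.cos ((x - s) * z) * Real.exp (-t * z ^ 2 / 2) =
      Real.sqrt (2 * Real.pi / t) / 2 *
        (Real.exp (-C * s) * Real.exp (-(x - s) ^ 2 / (2 * t))) := by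
    intro s
    have := aux_fourier t (x - s) ht
    simp_rw [mul_assoc]
    rw [integral_const_mul]
    linear_combination (Real.exp (-C * s) / 2) * this
  simp_rw [hL] at hswap hinner
  simp_rw [hR] at hswap
  rw [integral_const_mul, aux_shift t C x ht] at hswap
  have hcos : IntegrableOn (fun z : ℝ => Real.cos (x * z) * Real.exp (-t * z ^ 2 / 2))
      (Set.Ioi 0) := by
    refine Integrable.mono' hEO (by fun_prop) ?_
    refine Filter.Eventually.of_forall fun z => ?_
    rw [norm_mul, Real.norm_of_nonneg (Real.exp_pos _).le]
    exact mul_le_of_le_one_left (Real.exp_pos _).le (Real.abs_cos_le_one _)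
  have hsplit : ∀ z : ℝ, (z ^ 2 * Real.cos (x * z) / (C ^ 2 + z ^ 2) * Real.exp (-t * z ^ 2 / 2) -
          C * z * Real.sin (x * z) / (C ^ 2 + z ^ 2) * Real.exp (-t * z ^ 2 / 2)) =
      Real.cos (x * z) * Real.exp (-t * z ^ 2 / 2) -
        C * ((C * Real.cos (x * z) + z * Real.sin (x * z)) / (C ^ 2 + z ^ 2) *
        Real.exp (-t * z ^ 2 / 2)) := by
    intro z
    have hpos : C ^ 2 + z ^ 2 ≠ 0 := by positivity
    field_simp
    ring
  simp_rw [hsplit]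
  rw [integral_sub hcos (hinner.const_mul C), integral_const_mul, hswap, mul_sub,
    aux_fourier t x ht]
  have hk : Real.sqrt (2 * Real.pi / t) * Real.sqrt t * Real.sqrt (2 * Real.pi) =
      2 * Real.pi := by
    rw [← Real.sqrt_mul (by positivity), div_mul_cancel₀ _ ht.ne',
      Real.mul_self_sqrt (by positivity)]
  linear_combination (C * Real.exp (-C * x + t * C ^ 2 / 2) *
    (stdNormalCDF (Real.sqrt t * C - x / Real.sqrt t) - 1)) * hk
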